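/- arXiv:1108.4941 — 2 statements merged into one kernel-verified Lean document; each statement's English description precedes it below -/
import Mathlib

section
/- Let (Ω, μ) be a finite measure space, let γ > 1 be real, and set κ = min{2, γ}. Suppose f : Ω → ℝ is measurable and that for some D > 0 and some ε ∈ (0, 1] one has ∫_{\{|f| ≤ 1/2\}} |f|² dμ + ∫_{\{|f| > 1/2\}} |f|^γ dμ ≤ D ε². Then there exists a constant C > 0, depending only on γ, D, and μ(Ω) (and not on ε or f), such that ‖f‖_{L^κ(μ)} ≤ C ε and ‖f‖_{L^γ(μ)} ≤ C ε^{κ/γ}. -/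
open MeasureTheory ENNReal

/-- Pointwise Young-type bound by the truncated energy density, for small values. -/
lemma rpow_le_add_mul_sq {t ε κ p c : ℝ} (ht : 0 ≤ t) (ht1 : t ≤ 1) (hε : 0 < ε)
    (hκ : 0 < κ) (hκ2 : κ ≤ 2) (hp : κ ≤ p) (hc : 1 ≤ c) :
    t ^ p ≤ ε ^ κ + c * ε ^ (κ - 2) * t ^ 2 := by
  have hεκ : 0 < ε ^ (κ - 2) := Real.rpow_pos_of_pos hε _
  have h1 : t ^ p ≤ t ^ κ := by
    rcases ht.eq_or_lt with rfl | h
    · rw [Real.zero_rpow (by linarith), Real.zero_rpow hκ.ne']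
    · exact Real.rpow_le_rpow_of_exponent_ge h ht1 hp
  refine h1.trans ?_
  rcases le_or_gt t ε with h | h
  · have := Real.rpow_le_rpow ht h hκ.le
    have : 0 ≤ c * ε ^ (κ - 2) * t ^ 2 := by positivity
    linarith
  · have h0 : 0 < t := hε.trans h
    have h2 : t ^ κ = t ^ (κ - 2) * t ^ 2 := by
      rw [← Real.rpow_natCast t 2, ← Real.rpow_add h0]
      norm_num
    have h3 : t ^ (κ - 2) ≤ ε ^ (κ - 2) :=
      Real.rpow_le_rpow_of_nonpos hε h.le (by linarith)
    have h4 : ε ^ (κ - 2) ≤ c * ε ^ (κ - 2) := le_mul_of_one_le_left hεκ.le hc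
    have h5 : t ^ κ ≤ c * ε ^ (κ - 2) * t ^ 2 := by
      rw [h2]
      exact mul_le_mul_of_nonneg_right (h3.trans h4) (sq_nonneg t)
    have : 0 < ε ^ κ := Real.rpow_pos_of_pos hε _
    linarith

/-- Pointwise bound by the truncated energy density, for large values. -/
lemma rpow_le_add_mul_rpow {t ε κ p γ : ℝ} (ht : 1 / 2 < t) (hε : 0 < ε) (hε1 : ε ≤ 1)
    (hκ2 : κ ≤ 2) (hp0 : 0 ≤ p) (hp : p ≤ γ) :
    t ^ p ≤ ε ^ κ + 2 ^ γ * ε ^ (κ - 2) * t ^ γ := by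
  have ht0 : 0 < t := by linarith
  have h1 : t ^ p ≤ 2 ^ γ * t ^ γ := by
    rw [← Real.mul_rpow (by norm_num) ht0.le]
    exact (Real.rpow_le_rpow ht0.le (by linarith) hp0).trans
      (Real.rpow_le_rpow_of_exponent_le (by linarith) hp)
  have h2 : 1 ≤ ε ^ (κ - 2) :=
    Real.one_le_rpow_of_pos_of_le_one_of_nonpos hε hε1 (by linarith)
  have h3 : 0 ≤ (2 : ℝ) ^ γ * t ^ γ := by positivity
  have h4 : 0 < ε ^ κ := Real.rpow_pos_of_pos hε _
  nlinarith [mul_le_mul_of_nonneg_left h2 h3]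

/-- A bound on the truncated energy controls every `L^p` norm with `κ ≤ p ≤ γ`. -/
lemma eLpNorm_le_of_truncated_energy_le {Ω : Type*} [MeasurableSpace Ω]
    (μ : Measure Ω) [IsFiniteMeasure μ] {γ κ p D ε : ℝ} (hD : 0 < D) (hκ : 0 < κ) (hκ2 : κ ≤ 2)
    (hκp : κ ≤ p) (hpγ : p ≤ γ) (hp : 1 ≤ p) (hε : 0 < ε) (hε1 : ε ≤ 1)
    {f : Ω → ℝ} (hf : Measurable f)
    (h : (∫⁻ x in {x | |f x| ≤ 1/2}, ENNReal.ofReal (|f x| ^ 2) ∂μ)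
        + (∫⁻ x in {x | |f x| > 1/2}, ENNReal.ofReal (|f x| ^ γ) ∂μ)
        ≤ ENNReal.ofReal (D * ε ^ 2)) :
    eLpNorm f (ENNReal.ofReal p) μ
      ≤ ENNReal.ofReal ((1 + (μ.real Set.univ + 2 ^ γ * D)) * ε ^ (κ / p)) := by
  have hp0 : 0 < p := by linarith
  set s : Set Ω := {x | |f x| ≤ 1/2} with hs
  have hsm : MeasurableSet s := measurableSet_le hf.abs measurable_const
  have hsc : {x | |f x| > 1/2} = sᶜ := by ext x; simp [hs]
  rw [hsc] at h
  set M := μ.real Set.univ with hM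
  have hM0 : 0 ≤ M := measureReal_nonneg
  set a := ε ^ κ with ha
  set b := 2 ^ γ * ε ^ (κ - 2) with hb
  have ha0 : 0 < a := Real.rpow_pos_of_pos hε _
  have hb0 : 0 < b := mul_pos (by positivity) (Real.rpow_pos_of_pos hε _)
  have split : ∀ {y : ℝ}, 0 ≤ y → ENNReal.ofReal (a + b * y)
      = ENNReal.ofReal a + ENNReal.ofReal b * ENNReal.ofReal y := fun {y} hy => by
    rw [ENNReal.ofReal_add ha0.le (by positivity), ENNReal.ofReal_mul hb0.le]
  have hpow : ∀ x, ‖f x‖ₑ ^ p = ENNReal.ofReal (|f x| ^ p) := fun x => by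
    rw [← ENNReal.ofReal_rpow_of_nonneg (abs_nonneg _) hp0.le, ← Real.norm_eq_abs,
      ofReal_norm]
  have int_bound : ∀ (t : Set Ω) (g : Ω → ℝ), MeasurableSet t → Measurable g → (∀ x, 0 ≤ g x) →
      (∀ x ∈ t, |f x| ^ p ≤ a + b * g x) →
      ∫⁻ x in t, ‖f x‖ₑ ^ p ∂μ
        ≤ ENNReal.ofReal a * μ t + ENNReal.ofReal b * ∫⁻ x in t, ENNReal.ofReal (g x) ∂μ := by
    intro t g ht hg hg0 hle
    calc ∫⁻ x in t, ‖f x‖ₑ ^ p ∂μ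
        ≤ ∫⁻ x in t, (ENNReal.ofReal a + ENNReal.ofReal b * ENNReal.ofReal (g x)) ∂μ := by
          refine setLIntegral_mono' ht fun x hx => ?_
          rw [hpow, ← split (hg0 x)]
          exact ENNReal.ofReal_le_ofReal (hle x hx)
      _ = _ := by
          rw [lintegral_add_left measurable_const, setLIntegral_const,
            lintegral_const_mul _ hg.ennreal_ofReal]
  have hsmall := int_bound s (fun x => |f x| ^ 2) hsm (hf.abs.pow_const 2)
    (fun x => by positivity) fun x hx =>
      rpow_le_add_mul_sq (abs_nonneg _) (le_trans hx (by norm_num)) hε hκ hκ2 hκp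
        (Real.one_le_rpow (by norm_num) (by linarith))
  have hlarge := int_bound sᶜ (fun x => |f x| ^ γ) hsm.compl (hf.abs.pow_const γ)
    (fun x => by positivity) fun x hx =>
      rpow_le_add_mul_rpow (by simpa [hs] using hx) hε hε1 hκ2 hp0.le hpγ
  have hεκ : ε ^ (κ - 2) * ε ^ 2 = a := by
    rw [← Real.rpow_natCast ε 2, ← Real.rpow_add hε]
    norm_num [ha]
  have total : ∫⁻ x, ‖f x‖ₑ ^ p ∂μ ≤ ENNReal.ofReal ((M + 2 ^ γ * D) * a) := by
    rw [← lintegral_add_compl _ hsm]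
    calc _ ≤ _ := add_le_add hsmall hlarge
      _ = ENNReal.ofReal a * (μ s + μ sᶜ) + ENNReal.ofReal b *
          ((∫⁻ x in s, ENNReal.ofReal (|f x| ^ 2) ∂μ)
            + ∫⁻ x in sᶜ, ENNReal.ofReal (|f x| ^ γ) ∂μ) := by ring
      _ ≤ ENNReal.ofReal a * ENNReal.ofReal M
          + ENNReal.ofReal b * ENNReal.ofReal (D * ε ^ 2) := by
          rw [measure_add_measure_compl hsm, hM, ofReal_measureReal]
          gcongr
      _ = ENNReal.ofReal ((M + 2 ^ γ * D) * a) := by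
          rw [← ENNReal.ofReal_mul ha0.le, ← ENNReal.ofReal_mul hb0.le,
            ← ENNReal.ofReal_add (by positivity) (by positivity)]
          congr 1
          rw [hb, ← hεκ]
          ring
  have hA : 0 ≤ M + 2 ^ γ * D := by positivity
  rw [eLpNorm_eq_lintegral_rpow_enorm_toReal (by simpa using hp0) ENNReal.ofReal_ne_top,
    ENNReal.toReal_ofReal hp0.le]
  refine (ENNReal.rpow_le_rpow total (by positivity)).trans ?_
  rw [ENNReal.ofReal_rpow_of_nonneg (by positivity) (by positivity)]
  refine ENNReal.ofReal_le_ofReal ?_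
  rw [Real.mul_rpow hA ha0.le, ha, ← Real.rpow_mul hε.le, mul_one_div]
  refine mul_le_mul_of_nonneg_right ?_ (Real.rpow_nonneg hε.le _)
  calc (M + 2 ^ γ * D) ^ (1 / p) ≤ (1 + (M + 2 ^ γ * D)) ^ (1 / p) :=
        Real.rpow_le_rpow hA (by linarith) (by positivity)
    _ ≤ (1 + (M + 2 ^ γ * D)) ^ (1 : ℝ) :=
        Real.rpow_le_rpow_of_exponent_le (by linarith) (by rw [div_le_one hp0]; exact hp)
    _ = _ := Real.rpow_one _

/-- Let `(Ω, μ)` be a finite measure space, `γ > 1`, `κ = min 2 γ`. If `f` is measurable and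
`∫_{|f|≤1/2} |f|² dμ + ∫_{|f|>1/2} |f|^γ dμ ≤ D ε²` for some `D > 0` and `ε ∈ (0,1]`, then
there is `C > 0` depending only on `γ`, `D` and the measure space (through `μ(Ω)`), with
`‖f‖_{L^κ(μ)} ≤ C ε` and `‖f‖_{L^γ(μ)} ≤ C ε^{κ/γ}`. -/
theorem density_fluctuation_Lp_estimate {Ω : Type*} [MeasurableSpace Ω]
    (μ : Measure Ω) [IsFiniteMeasure μ] (γ : ℝ) (hγ : 1 < γ) (D : ℝ) (hD : 0 < D) :
    ∃ C : ℝ, 0 < C ∧ ∀ ε : ℝ, 0 < ε → ε ≤ 1 → ∀ f : Ω → ℝ, Measurable f →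
      (∫⁻ x in {x | |f x| ≤ 1/2}, ENNReal.ofReal (|f x| ^ 2) ∂μ)
        + (∫⁻ x in {x | |f x| > 1/2}, ENNReal.ofReal (|f x| ^ γ) ∂μ)
        ≤ ENNReal.ofReal (D * ε ^ 2) →
      eLpNorm f (ENNReal.ofReal (min 2 γ)) μ ≤ ENNReal.ofReal (C * ε) ∧
      eLpNorm f (ENNReal.ofReal γ) μ ≤ ENNReal.ofReal (C * ε ^ (min 2 γ / γ)) := by
  have hκ : 1 ≤ min 2 γ := le_min one_le_two hγ.le
  refine ⟨1 + (μ.real Set.univ + 2 ^ γ * D), by positivity, fun ε hε hε1 f hf h => ⟨?_, ?_⟩⟩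
  · have := eLpNorm_le_of_truncated_energy_le μ hD (by linarith) (min_le_left 2 γ) le_rfl
      (min_le_right 2 γ) hκ hε hε1 hf h
    rwa [div_self (by linarith), Real.rpow_one] at this
  · exact eLpNorm_le_of_truncated_energy_le μ hD (by linarith) (min_le_left 2 γ)
      (min_le_right 2 γ) le_rfl hγ.le hε hε1 hf h
end

section
/- Let Ω ⊆ ℝ³ be open, let λ ∈ ℝ, and let Φ, Ψ : Ω → ℝ be twice continuously differentiable with ΔΦ = −λ²Φ and ΔΨ = −λ²Ψ on Ω. Then for each i = 1, 2, 3 and every x ∈ Ω, Σ_{j=1}^3 ∂_{x_j}( ∂_{x_i}Φ ∂_{x_j}Ψ + ∂_{x_i}Ψ ∂_{x_j}Φ )(x) = ∂_{x_i}( −λ² Φ Ψ + Σ_{j=1}^3 ∂_{x_j}Φ ∂_{x_j}Ψ )(x); that is, div(∇Φ ⊗ ∇Ψ + ∇Ψ ⊗ ∇Φ) = −λ² ∇(ΦΨ) + ∇(∇Φ · ∇Ψ). -/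
/-- Partial derivative in the `j`-th coordinate direction of a function on `ℝ³`. -/
noncomputable def pd (j : Fin 3) (g : (Fin 3 → ℝ) → ℝ) (x : Fin 3 → ℝ) : ℝ :=
  fderiv ℝ g x (Pi.single j 1)

section PartialDerivatives

variable {f g : (Fin 3 → ℝ) → ℝ} {x : Fin 3 → ℝ}

theorem pd_add (j : Fin 3) (hf : DifferentiableAt ℝ f x) (hg : DifferentiableAt ℝ g x) :
    pd j (fun y => f y + g y) x = pd j f x + pd j g x := by
  simp only [pd, fderiv_fun_add hf hg, add_apply]

theorem pd_mul (j : Fin 3) (hf : DifferentiableAt ℝ f x) (hg : DifferentiableAt ℝ g x) :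
    pd j (fun y => f y * g y) x = f x * pd j g x + g x * pd j f x := by
  simp only [pd, fderiv_fun_mul hf hg, add_apply, smul_apply, smul_eq_mul]

theorem pd_const_mul (j : Fin 3) (c : ℝ) (hf : DifferentiableAt ℝ f x) :
    pd j (fun y => c * f y) x = c * pd j f x := by
  simp only [pd, fderiv_const_mul hf, smul_apply, smul_eq_mul]

theorem pd_sum {ι : Type*} (j : Fin 3) (s : Finset ι) {F : ι → (Fin 3 → ℝ) → ℝ}
    (hF : ∀ k ∈ s, DifferentiableAt ℝ (F k) x) :
    pd j (fun y => ∑ k ∈ s, F k y) x = ∑ k ∈ s, pd j (F k) x := by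
  simp only [pd, fderiv_fun_sum hF, sum_apply]

theorem ContDiffAt.differentiableAt_fderiv (hf : ContDiffAt ℝ 2 f x) :
    DifferentiableAt ℝ (fderiv ℝ f) x :=
  (hf.fderiv_right (m := 1) (by norm_num)).differentiableAt one_ne_zero

theorem ContDiffAt.differentiableAt_pd (hf : ContDiffAt ℝ 2 f x) (j : Fin 3) :
    DifferentiableAt ℝ (pd j f) x :=
  hf.differentiableAt_fderiv.clm_apply (differentiableAt_const _)

theorem pd_pd_eq_fderiv_fderiv (hf : ContDiffAt ℝ 2 f x) (i j : Fin 3) :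
    pd i (pd j f) x = fderiv ℝ (fderiv ℝ f) x (Pi.single i 1) (Pi.single j 1) := by
  change fderiv ℝ (fun y => fderiv ℝ f y (Pi.single j 1)) x (Pi.single i 1) = _
  rw [fderiv_clm_apply hf.differentiableAt_fderiv (differentiableAt_const _)]
  simp

theorem pd_comm (hf : ContDiffAt ℝ 2 f x) (i j : Fin 3) :
    pd i (pd j f) x = pd j (pd i f) x := by
  rw [pd_pd_eq_fderiv_fderiv hf, pd_pd_eq_fderiv_fderiv hf]
  exact hf.isSymmSndFDerivAt (by simp) _ _

end PartialDerivatives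

/-- If `Φ, Ψ` are `C²` on an open `Ω ⊆ ℝ³` with `ΔΦ = −λ²Φ` and `ΔΨ = −λ²Ψ` on `Ω`, then
`div(∇Φ ⊗ ∇Ψ + ∇Ψ ⊗ ∇Φ) = −λ² ∇(ΦΨ) + ∇(∇Φ · ∇Ψ)` on `Ω`. -/
theorem eigenmode_interaction_is_gradient (Ω : Set (Fin 3 → ℝ)) (hΩ : IsOpen Ω) (l : ℝ)
    (Φ Ψ : (Fin 3 → ℝ) → ℝ) (hΦ : ContDiffOn ℝ 2 Φ Ω) (hΨ : ContDiffOn ℝ 2 Ψ Ω)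
    (hΦeig : ∀ x ∈ Ω, ∑ j : Fin 3, pd j (pd j Φ) x = -l ^ 2 * Φ x)
    (hΨeig : ∀ x ∈ Ω, ∑ j : Fin 3, pd j (pd j Ψ) x = -l ^ 2 * Ψ x) :
    ∀ i : Fin 3, ∀ x ∈ Ω,
      ∑ j : Fin 3, pd j (fun y => pd i Φ y * pd j Ψ y + pd i Ψ y * pd j Φ y) x
        = pd i (fun y => -l ^ 2 * (Φ y * Ψ y) + ∑ j : Fin 3, pd j Φ y * pd j Ψ y) x := by
  intro i x hx
  have hΦx : ContDiffAt ℝ 2 Φ x := hΦ.contDiffAt (hΩ.mem_nhds hx)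
  have hΨx : ContDiffAt ℝ 2 Ψ x := hΨ.contDiffAt (hΩ.mem_nhds hx)
  have dΦ : DifferentiableAt ℝ Φ x := hΦx.differentiableAt two_ne_zero
  have dΨ : DifferentiableAt ℝ Ψ x := hΨx.differentiableAt two_ne_zero
  have dpΦ := hΦx.differentiableAt_pd
  have dpΨ := hΨx.differentiableAt_pd
  have lhs : ∀ j : Fin 3, pd j (fun y => pd i Φ y * pd j Ψ y + pd i Ψ y * pd j Φ y) x
      = pd i Φ x * pd j (pd j Ψ) x + pd i Ψ x * pd j (pd j Φ) x
        + (pd j Φ x * pd i (pd j Ψ) x + pd j Ψ x * pd i (pd j Φ) x) := by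
    intro j
    rw [pd_add j ((dpΦ i).fun_mul (dpΨ j)) ((dpΨ i).fun_mul (dpΦ j)),
      pd_mul j (dpΦ i) (dpΨ j), pd_mul j (dpΨ i) (dpΦ j), pd_comm hΦx j i, pd_comm hΨx j i]
    ring
  have rhs : pd i (fun y => -l ^ 2 * (Φ y * Ψ y) + ∑ j : Fin 3, pd j Φ y * pd j Ψ y) x
      = -l ^ 2 * (Φ x * pd i Ψ x + Ψ x * pd i Φ x)
        + ∑ j : Fin 3, (pd j Φ x * pd i (pd j Ψ) x + pd j Ψ x * pd i (pd j Φ) x) := by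
    rw [pd_add i ((dΦ.fun_mul dΨ).const_mul _)
        (DifferentiableAt.fun_sum fun j _ => (dpΦ j).fun_mul (dpΨ j)),
      pd_const_mul i _ (dΦ.fun_mul dΨ), pd_mul i dΦ dΨ,
      pd_sum i _ fun j _ => (dpΦ j).fun_mul (dpΨ j)]
    simp only [pd_mul i (dpΦ _) (dpΨ _)]
  simp only [lhs, rhs, Finset.sum_add_distrib, ← Finset.mul_sum, hΦeig x hx, hΨeig x hx]
  ring
end
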